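/- arXiv:2310.19098 — 3 statements merged into one kernel-verified Lean document; each statement's English description precedes it below -/
import Mathlib

section
/- Fix an integer k ≥ 1. For every integer n ≥ 0, the sum over all partitions λ of n of the number of parts of λ equal to k is equal to the sum over all partitions λ of n of the number of distinct part sizes of λ that occur at least k times in λ. -/
namespace Nat.Partition

variable {n : ℕ}

/-- Replace `a` parts equal to `b` by `b` parts equal to `a`. -/
def conjugateRectangle (a b : ℕ) (ha : 0 < a) (P : Nat.Partition n) (h : a ≤ P.parts.count b) :
    Nat.Partition n where
  parts := P.parts - Multiset.replicate a b + Multiset.replicate b a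
  parts_pos {i} hi := by
    rcases Multiset.mem_add.1 hi with hi | hi
    · exact P.parts_pos (Multiset.mem_of_le (Multiset.sub_le_self _ _) hi)
    · rwa [Multiset.eq_of_mem_replicate hi]
  parts_sum := by
    have hle : Multiset.replicate a b ≤ P.parts := Multiset.le_count_iff_replicate_le.1 h
    have hsum := congrArg Multiset.sum (Multiset.sub_add_cancel hle)
    simp only [Multiset.sum_add, Multiset.sum_replicate, smul_eq_mul, P.parts_sum] at hsum ⊢
    rw [mul_comm b a, hsum]

theorem card_filter_le_count_le (a b : ℕ) (ha : 0 < a) :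
    (Finset.univ.filter fun P : Nat.Partition n => a ≤ P.parts.count b).card ≤
      (Finset.univ.filter fun P : Nat.Partition n => b ≤ P.parts.count a).card := by
  refine Finset.card_le_card_of_injOn
    (fun P => if h : a ≤ P.parts.count b then conjugateRectangle a b ha P h else P) ?_ ?_
  · intro P hP
    have h : a ≤ P.parts.count b := by simpa using hP
    simp [h, conjugateRectangle]
  · intro P hP Q hQ hPQ
    have h : a ≤ P.parts.count b := by simpa using hP
    have h' : a ≤ Q.parts.count b := by simpa using hQ
    simp only [h, h', dite_true, conjugateRectangle, Nat.Partition.mk.injEq,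
      add_left_inj] at hPQ
    rw [Multiset.le_count_iff_replicate_le] at h h'
    apply Nat.Partition.ext
    rw [← Multiset.sub_add_cancel h, hPQ, Multiset.sub_add_cancel h']

/-- The number of partitions of `n` with at least `a` parts equal to `b` is symmetric in
`a` and `b`. -/
theorem card_filter_le_count_comm (a b : ℕ) (ha : 0 < a) (hb : 0 < b) :
    (Finset.univ.filter fun P : Nat.Partition n => a ≤ P.parts.count b).card =
      (Finset.univ.filter fun P : Nat.Partition n => b ≤ P.parts.count a).card :=
  (card_filter_le_count_le a b ha).antisymm (card_filter_le_count_le b a hb)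

theorem count_le (P : Nat.Partition n) {k : ℕ} (hk : 0 < k) : P.parts.count k ≤ n := by
  obtain ⟨t, ht⟩ := Multiset.le_iff_exists_add.1
    (Multiset.le_count_iff_replicate_le.1 (le_refl (P.parts.count k)))
  have h := congrArg Multiset.sum ht
  rw [Multiset.sum_add, Multiset.sum_replicate, smul_eq_mul, P.parts_sum] at h
  exact (Nat.le_mul_of_pos_right _ hk).trans ((Nat.le_add_right _ _).trans h.ge)

end Nat.Partition


/-- Fine's theorem (sometimes called Stanley's theorem): for fixed `k ≥ 1` and any `n ≥ 0`,
the total number of parts equal to `k` over all partitions of `n` equals the total number of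
distinct part sizes occurring at least `k` times, summed over all partitions of `n`. -/
theorem fine_stanley (k : ℕ) (hk : 1 ≤ k) (n : ℕ) :
    ∑ P : Nat.Partition n, P.parts.count k =
      ∑ P : Nat.Partition n,
        (P.parts.toFinset.filter (fun i => k ≤ P.parts.count i)).card := by
  have hcount (P : Nat.Partition n) :
      P.parts.count k = ((Finset.Icc 1 n).filter fun j => j ≤ P.parts.count k).card := by
    have h : ((Finset.Icc 1 n).filter fun j => j ≤ P.parts.count k) =
        Finset.Icc 1 (P.parts.count k) := by
      ext j
      have := P.count_le hk
      simp only [Finset.mem_filter, Finset.mem_Icc]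
      omega
    rw [h, Nat.card_Icc, Nat.add_sub_cancel]
  have hsizes (P : Nat.Partition n) :
      (P.parts.toFinset.filter fun i => k ≤ P.parts.count i) =
        (Finset.Icc 1 n).filter fun j => k ≤ P.parts.count j := by
    ext j
    simp only [Finset.mem_filter, Multiset.mem_toFinset, Finset.mem_Icc]
    refine and_congr_left fun hj => ⟨fun h => ⟨P.parts_pos h, P.le_of_mem_parts h⟩, fun _ => ?_⟩
    exact Multiset.count_pos.1 (hk.trans hj)
  simp_rw [hsizes]
  rw [Finset.sum_congr rfl fun P _ => hcount P]
  simp only [Finset.card_filter]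
  rw [Finset.sum_comm, Finset.sum_comm (s := Finset.univ)]
  refine Finset.sum_congr rfl fun j hj => ?_
  simpa only [Finset.card_filter] using
    Nat.Partition.card_filter_le_count_comm (n := n) j k (Finset.mem_Icc.1 hj).1 hk
end

section
/- For every integer n ≥ 0, S_1(n) = ∑_{k=2}^{n+1} φ(k) · S_k^{≥2}(n+1), where φ is Euler's totient function. -/
/-- `S_k^{≥ r}(n)`: the total number of parts equal to `k`, counted over all partitions of `n`
whose parts are all at least `r`. -/
def Sge (k r n : ℕ) : ℕ :=
  ∑ P : Nat.Partition n, if ∀ i ∈ P.parts, r ≤ i then P.parts.count k else 0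

open Finset

/-- The number of partitions of `n` whose parts are all at least `r`. -/
def cardGe (r n : ℕ) : ℕ :=
  ∑ P : Nat.Partition n, if ∀ i ∈ P.parts, r ≤ i then 1 else 0

/-- Removing one part equal to `k` turns a sum over the partitions of `n + k` that contain `k`
into a sum over the partitions of `n`. -/
theorem sum_partition_of_mem_parts {k : ℕ} (hk : 1 ≤ k) (n : ℕ) (f : Multiset ℕ → ℕ) :
    (∑ P : Nat.Partition (n + k), if k ∈ P.parts then f P.parts else 0) =
      ∑ Q : Nat.Partition n, f (k ::ₘ Q.parts) := by
  rw [← sum_filter]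
  refine sum_bij' (fun P hP ↦ ⟨P.parts.erase k, fun hi ↦ P.parts_pos (Multiset.mem_of_mem_erase hi),
      ?_⟩) (fun Q _ ↦ ⟨k ::ₘ Q.parts, ?_, ?_⟩) ?_ ?_ ?_ ?_ ?_
  · have := congrArg Multiset.sum (Multiset.cons_erase (mem_filter.mp hP).2)
    rw [P.parts_sum, Multiset.sum_cons] at this
    omega
  · intro i hi
    rcases Multiset.mem_cons.mp hi with rfl | hi
    · exact hk
    · exact Q.parts_pos hi
  · rw [Multiset.sum_cons, Q.parts_sum, add_comm]
  · simp
  · simp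
  · intro P hP
    exact Nat.Partition.ext (Multiset.cons_erase (mem_filter.mp hP).2)
  · intro Q _
    exact Nat.Partition.ext (Multiset.erase_cons_head k Q.parts)
  · intro P hP
    simp only [Multiset.cons_erase (mem_filter.mp hP).2]

theorem Sge_of_lt {k n : ℕ} (r : ℕ) (h : n < k) : Sge k r n = 0 := by
  refine sum_eq_zero fun P _ ↦ ?_
  have : k ∉ P.parts := fun hk ↦ absurd (Nat.Partition.le_of_mem_parts hk) (by omega)
  simp [Multiset.count_eq_zero_of_notMem this]

theorem Sge_add_self {k r : ℕ} (hk : 1 ≤ k) (hr : r ≤ k) (n : ℕ) :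
    Sge k r (n + k) = cardGe r n + Sge k r n := by
  have h := sum_partition_of_mem_parts hk n
    (fun s ↦ if ∀ i ∈ s, r ≤ i then s.count k else 0)
  calc Sge k r (n + k) = _ := sum_congr rfl fun P _ ↦ ?_
    _ = _ := h
    _ = _ := by
      rw [cardGe, Sge, ← sum_add_distrib]
      refine sum_congr rfl fun Q _ ↦ ?_
      simp only [Multiset.forall_mem_cons, hr, true_and, Multiset.count_cons_self]
      split_ifs <;> omega
  by_cases hP : k ∈ P.parts
  · simp [hP]
  · simp [hP]

theorem cardGe_one_succ (n : ℕ) : cardGe 1 (n + 1) = cardGe 1 n + cardGe 2 (n + 1) := by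
  have h := sum_partition_of_mem_parts le_rfl n (fun s ↦ if ∀ i ∈ s, 1 ≤ i then 1 else 0)
  simp only [Multiset.forall_mem_cons, le_refl, true_and] at h
  rw [cardGe, cardGe, cardGe, ← h, ← sum_add_distrib]
  refine sum_congr rfl fun P _ ↦ ?_
  have h1 : ∀ i ∈ P.parts, 1 ≤ i := fun i hi ↦ P.parts_pos hi
  by_cases hP : 1 ∈ P.parts
  · have : ¬ ∀ i ∈ P.parts, 2 ≤ i := fun h ↦ absurd (h 1 hP) (by omega)
    rw [if_pos h1, if_pos hP, if_neg this]
  · have : ∀ i ∈ P.parts, 2 ≤ i := fun i hi ↦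
      lt_of_le_of_ne (h1 i hi) fun h ↦ hP (h ▸ hi)
    rw [if_pos h1, if_neg hP, if_pos this]

theorem cardGe_one_eq_sum (n : ℕ) : cardGe 1 n = ∑ i ∈ range (n + 1), cardGe 2 i := by
  induction n with
  | zero => simp [cardGe]
  | succ n ih => rw [sum_range_succ, ← ih, cardGe_one_succ]

theorem Sge_eq_sum_cardGe {k r : ℕ} (hk : 1 ≤ k) (hr : r ≤ k) (n : ℕ) :
    Sge k r n = ∑ i ∈ range n, if k ∣ n - i then cardGe r i else 0 := by
  induction n using Nat.strong_induction_on with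
  | _ n ih =>
    rcases lt_or_ge n k with hn | hn
    · rw [Sge_of_lt r hn]
      refine (sum_eq_zero fun i hi ↦ if_neg fun hd ↦ ?_).symm
      have := mem_range.mp hi
      have := Nat.le_of_dvd (by omega) hd
      omega
    · obtain ⟨m, rfl⟩ := Nat.exists_eq_add_of_le' hn
      have hsub : range (m + 1) ⊆ range (m + k) := range_subset_range.mpr (by omega)
      rw [Sge_add_self hk hr, ih m (by omega), ← sum_subset hsub, sum_range_succ, add_comm]
      · congr 1
        · refine sum_congr rfl fun i hi ↦ ?_
          have := mem_range.mp hi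
          simp only [show m + k - i = m - i + k by omega, Nat.dvd_add_self_right]
        · simp
      · intro i hi hi'
        simp only [mem_range] at hi hi'
        refine if_neg fun hd ↦ ?_
        have := Nat.le_of_dvd (by omega) hd
        omega

theorem sum_totient_Icc_two {m n : ℕ} (hm : 1 ≤ m) (hn : m ≤ n) :
    (∑ k ∈ Icc 2 n, if k ∣ m then Nat.totient k else 0) = m - 1 := by
  have h : m.divisors = insert 1 ((Icc 2 n).filter (· ∣ m)) := by
    ext k
    simp only [Nat.mem_divisors, mem_insert, mem_filter, mem_Icc]
    constructor
    · rintro ⟨hd, _⟩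
      have := Nat.le_of_dvd hm hd
      have := Nat.pos_of_dvd_of_pos hd hm
      by_cases k = 1
      · exact Or.inl ‹_›
      · exact Or.inr ⟨⟨by omega, by omega⟩, hd⟩
    · rintro (rfl | ⟨_, hd⟩)
      · exact ⟨one_dvd m, by omega⟩
      · exact ⟨hd, by omega⟩
  have hs := Nat.sum_totient m
  rw [h, sum_insert (by simp), Nat.totient_one] at hs
  rw [← sum_filter]
  omega

theorem sum_cardGe_one (n : ℕ) :
    ∑ i ∈ range n, cardGe 1 i = ∑ i ∈ range (n + 1), (n - i) * cardGe 2 i := by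
  induction n with
  | zero => simp
  | succ n ih =>
    rw [sum_range_succ, ih, cardGe_one_eq_sum, ← sum_add_distrib, sum_range_succ _ (n + 1),
      Nat.sub_self, zero_mul, add_zero]
    refine sum_congr rfl fun i hi ↦ ?_
    have := mem_range.mp hi
    rw [show n + 1 - i = n - i + 1 by omega, add_mul, one_mul]

/-- For every `n ≥ 0`, `S_1(n) = ∑_{k=2}^{n+1} φ(k) · S_k^{≥2}(n+1)`. -/
theorem S_one_eq_sum_totient (n : ℕ) :
    Sge 1 1 n = ∑ k ∈ Finset.Icc 2 (n + 1), Nat.totient k * Sge k 2 (n + 1) := by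
  have hS : ∀ k ∈ Icc 2 (n + 1), Nat.totient k * Sge k 2 (n + 1) =
      ∑ i ∈ range (n + 1), (if k ∣ n + 1 - i then Nat.totient k else 0) * cardGe 2 i := by
    intro k hk
    have := (mem_Icc.mp hk).1
    rw [Sge_eq_sum_cardGe (by omega) this, mul_sum]
    refine sum_congr rfl fun i _ ↦ ?_
    split_ifs <;> simp
  rw [sum_congr rfl hS, sum_comm, Sge_eq_sum_cardGe le_rfl le_rfl]
  simp only [one_dvd, if_true]
  rw [sum_cardGe_one]
  refine sum_congr rfl fun i hi ↦ ?_
  have := mem_range.mp hi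
  rw [← sum_mul, sum_totient_Icc_two (by omega) (by omega)]
  congr 1
  omega
end

section
/- For every integer n ≥ 0, p(n) = ∑_{k=1}^{n+1} S_k(n+1) · μ(k), where p(n) is the number of partitions of n and μ is the Möbius function (the sum is taken in the integers). -/
/-- `S_k(n)`: the total number of parts equal to `k`, counted over all partitions of `n`. -/
def Spart (k n : ℕ) : ℕ :=
  ∑ P : Nat.Partition n, P.parts.count k

/-- Removing `m` copies of `k` identifies the partitions of `n + m * k` having at least `m` parts
equal to `k` with the partitions of `n`. -/
def partitionRemoveEquiv (n m k : ℕ) (hk : 0 < k) :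
    {P : Nat.Partition (n + m * k) // m ≤ P.parts.count k} ≃ Nat.Partition n where
  toFun P :=
    { parts := P.1.parts - Multiset.replicate m k
      parts_pos := fun hi => P.1.parts_pos (Multiset.mem_of_le (Multiset.sub_le_self _ _) hi)
      parts_sum := by
        have h := congrArg Multiset.sum
          (Multiset.sub_add_cancel (Multiset.le_count_iff_replicate_le.1 P.2))
        rw [Multiset.sum_add, P.1.parts_sum, Multiset.sum_replicate, smul_eq_mul] at h
        exact Nat.add_right_cancel h }
  invFun Q :=
    ⟨{ parts := Q.parts + Multiset.replicate m k
       parts_pos := fun hi => by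
        rcases Multiset.mem_add.1 hi with h | h
        · exact Q.parts_pos h
        · rwa [Multiset.eq_of_mem_replicate h]
       parts_sum := by simp [Q.parts_sum] }, by simp⟩
  left_inv P := Subtype.ext <| Nat.Partition.ext <|
    Multiset.sub_add_cancel (Multiset.le_count_iff_replicate_le.1 P.2)
  right_inv Q := Nat.Partition.ext <| Multiset.add_sub_cancel_right ..

theorem card_filter_le_count_parts {N k d : ℕ} (hk : 0 < k) (hd : d ≤ N) (hkd : k ∣ d) :
    (Finset.univ.filter fun P : Nat.Partition N => d / k ≤ P.parts.count k).card =
      Fintype.card (Nat.Partition (N - d)) := by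
  obtain ⟨m, rfl⟩ := hkd
  obtain ⟨n, rfl⟩ := Nat.exists_eq_add_of_le' hd
  rw [Nat.mul_div_cancel_left m hk, Nat.add_sub_cancel, mul_comm k m, ← Fintype.card_subtype]
  exact Fintype.card_congr (partitionRemoveEquiv n m k hk)

theorem count_parts_eq_card {N k : ℕ} (hk : 0 < k) (P : Nat.Partition N) :
    P.parts.count k =
      (((Finset.Icc 1 N).filter (k ∣ ·)).filter (· / k ≤ P.parts.count k)).card := by
  have hle : P.parts.count k * k ≤ N := by
    obtain ⟨t, ht⟩ := Multiset.le_iff_exists_add.1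
      (Multiset.le_count_iff_replicate_le.1 (le_refl (P.parts.count k)))
    have h := congrArg Multiset.sum ht
    rw [P.parts_sum, Multiset.sum_add, Multiset.sum_replicate, smul_eq_mul] at h
    omega
  have himage : ((Finset.Icc 1 N).filter (k ∣ ·)).filter (· / k ≤ P.parts.count k) =
      (Finset.Icc 1 (P.parts.count k)).image (· * k) := by
    ext d
    simp only [Finset.mem_filter, Finset.mem_Icc, Finset.mem_image]
    constructor
    · rintro ⟨⟨⟨h1, _⟩, m, rfl⟩, hm⟩
      rw [Nat.mul_div_cancel_left m hk] at hm
      exact ⟨m, ⟨Nat.pos_of_mul_pos_left h1, hm⟩, mul_comm m k⟩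
    · rintro ⟨m, ⟨h1, hm⟩, rfl⟩
      exact ⟨⟨⟨Nat.mul_pos h1 hk, (Nat.mul_le_mul_right k hm).trans hle⟩, dvd_mul_left k m⟩,
        by rwa [Nat.mul_div_cancel m hk]⟩
  rw [himage, Finset.card_image_of_injective _ (mul_left_injective₀ hk.ne'), Nat.card_Icc,
    Nat.add_sub_cancel]

theorem Spart_eq_sum_card {k : ℕ} (hk : 0 < k) (N : ℕ) :
    Spart k N = ∑ d ∈ (Finset.Icc 1 N).filter (k ∣ ·), Fintype.card (Nat.Partition (N - d)) := by
  rw [Spart, Finset.sum_congr rfl fun P _ => count_parts_eq_card hk P]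
  simp_rw [Finset.card_filter _ (Finset.filter _ _)]
  rw [Finset.sum_comm]
  refine Finset.sum_congr rfl fun d hd => ?_
  obtain ⟨hd, hkd⟩ := Finset.mem_filter.1 hd
  rw [← Finset.card_filter, card_filter_le_count_parts hk (Finset.mem_Icc.1 hd).2 hkd]

theorem sum_moebius_filter_dvd {N d : ℕ} (hd : d ∈ Finset.Icc 1 N) :
    ∑ k ∈ (Finset.Icc 1 N).filter (· ∣ d), ArithmeticFunction.moebius k =
      if d = 1 then 1 else 0 := by
  rw [← ArithmeticFunction.one_apply, ← ArithmeticFunction.moebius_mul_coe_zeta,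
    ArithmeticFunction.coe_mul_zeta_apply]
  refine Finset.sum_congr ?_ fun _ _ => rfl
  ext k
  simp only [Finset.mem_filter, Finset.mem_Icc, Nat.mem_divisors] at hd ⊢
  constructor
  · rintro ⟨_, h⟩
    exact ⟨h, by omega⟩
  · rintro ⟨h, _⟩
    exact ⟨⟨Nat.pos_of_dvd_of_pos h hd.1, (Nat.le_of_dvd hd.1 h).trans hd.2⟩, h⟩

/-- For every `n ≥ 0`, `p(n) = ∑_{k=1}^{n+1} S_k(n+1) · μ(k)` (in the integers). -/
theorem partition_eq_sum_moebius (n : ℕ) :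
    (Fintype.card (Nat.Partition n) : ℤ) =
      ∑ k ∈ Finset.Icc 1 (n + 1), (Spart k (n + 1) : ℤ) * ArithmeticFunction.moebius k := by
  symm
  calc
    _ = ∑ k ∈ Finset.Icc 1 (n + 1), ∑ d ∈ Finset.Icc 1 (n + 1), if k ∣ d then
          (Fintype.card (Nat.Partition (n + 1 - d)) : ℤ) * ArithmeticFunction.moebius k else 0 := by
      refine Finset.sum_congr rfl fun k hk => ?_
      rw [Spart_eq_sum_card (Finset.mem_Icc.1 hk).1, Nat.cast_sum, Finset.sum_mul,
        Finset.sum_filter]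
    _ = ∑ d ∈ Finset.Icc 1 (n + 1), (Fintype.card (Nat.Partition (n + 1 - d)) : ℤ) *
          if d = 1 then 1 else 0 := by
      rw [Finset.sum_comm]
      refine Finset.sum_congr rfl fun d hd => ?_
      rw [← Finset.sum_filter, ← Finset.mul_sum, sum_moebius_filter_dvd hd]
    _ = _ := by simp
end
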